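/- Let N ≥ 2, let λ : {1,…,N} → ℝ be nondecreasing, set λ_avg = (1/N) Σ_{n=1}^N λ_n, and suppose J ∈ {1,…,N−1} satisfies λ_J ≤ λ_avg < λ_{J+1}. Let K satisfy 1 ≤ K ≤ J, let h : {1,…,N} → ℝ with m := min_{1 ≤ n ≤ K} |h_n| > 0, and define η_K := (max_{K+1 ≤ n ≤ N} |h_n|) / m. If η_K² < (Σ_{n=1}^K (λ_n − λ_avg)) / (Σ_{n=1}^J (λ_n − λ_avg)), then Σ_{n=1}^N (λ_n − λ_avg) h_n² < 0, i.e. N · Σ_{n=1}^N λ_n h_n² < (Σ_{n=1}^N λ_n)(Σ_{n=1}^N h_n²). -/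

import Mathlib

/-- A sum over `1, …, c` splits at any `b ≤ c`. -/
lemma sum_Icc_one_eq_add_sum_Ioc (f : ℕ → ℝ) {b c : ℕ} (hbc : b ≤ c) :
    ∑ n ∈ Finset.Icc 1 c, f n = ∑ n ∈ Finset.Icc 1 b, f n + ∑ n ∈ Finset.Ioc b c, f n := by
  have hIcc : ∀ d : ℕ, Finset.Icc 1 d = Finset.Ioc 0 d := fun d => by
    ext n
    simp only [Finset.mem_Icc, Finset.mem_Ioc]
    omega
  rw [hIcc, hIcc, Finset.sum_Ioc_consecutive f (Nat.zero_le b) hbc]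

/-- Claim 1: a graph low-pass filter of order `K ≤ J` whose ratio `η_K` satisfies
`η_K² < (∑_{n≤K} (λ_n − λ_avg)) / (∑_{n≤J} (λ_n − λ_avg))` is a smooth graph filter,
where `J` is the index with `λ_J ≤ λ_avg < λ_{J+1}`. -/
theorem smooth_of_lpf_condition
    (N J K : ℕ) (hN : 2 ≤ N) (lam h : ℕ → ℝ)
    (hlam_mono : ∀ i j, 1 ≤ i → i ≤ j → j ≤ N → lam i ≤ lam j)
    (lamavg : ℝ) (hlamavg : lamavg = (∑ n ∈ Finset.Icc 1 N, lam n) / N)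
    (hJ1 : 1 ≤ J) (hJN : J ≤ N - 1)
    (hJle : lam J ≤ lamavg) (hJlt : lamavg < lam (J + 1))
    (hK1 : 1 ≤ K) (hKJ : K ≤ J)
    (m : ℝ)
    (hm : m = (Finset.Icc 1 K).inf' (Finset.nonempty_Icc.mpr hK1) (fun n => |h n|))
    (hm_pos : 0 < m)
    (etaK : ℝ)
    (hetaK : etaK =
      ((Finset.Icc (K + 1) N).sup'
        (Finset.nonempty_Icc.mpr (by omega)) (fun n => |h n|)) / m)
    (hcond : etaK ^ 2 <
      (∑ n ∈ Finset.Icc 1 K, (lam n - lamavg)) /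
        (∑ n ∈ Finset.Icc 1 J, (lam n - lamavg))) :
    ∑ n ∈ Finset.Icc 1 N, (lam n - lamavg) * (h n) ^ 2 < 0 ∧
      (N : ℝ) * ∑ n ∈ Finset.Icc 1 N, lam n * (h n) ^ 2 <
        (∑ n ∈ Finset.Icc 1 N, lam n) * (∑ n ∈ Finset.Icc 1 N, (h n) ^ 2) := by
  have hN0 : (N : ℝ) ≠ 0 := by
    have : N ≠ 0 := by omega
    exact_mod_cast this
  have hsum : ∑ n ∈ Finset.Icc 1 N, lam n = N * lamavg := by
    rw [hlamavg]
    field_simp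
  have hzero : ∑ n ∈ Finset.Icc 1 N, (lam n - lamavg) = 0 := by
    rw [Finset.sum_sub_distrib, hsum]
    simp
  have hnonpos : ∀ n, 1 ≤ n → n ≤ J → lam n - lamavg ≤ 0 := fun n h1 h2 => by
    linarith [hlam_mono n J h1 h2 (by omega)]
  have hnonneg : ∀ n, J < n → n ≤ N → 0 ≤ lam n - lamavg := fun n h1 h2 => by
    linarith [hlam_mono (J + 1) n (by omega) h1 h2]
  have hm_le : ∀ n ∈ Finset.Icc 1 K, m ^ 2 ≤ (h n) ^ 2 := fun n hn => by
    have hle : m ≤ |h n| := hm ▸ Finset.inf'_le (fun n => |h n|) hn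
    rw [← sq_abs (h n)]
    exact pow_le_pow_left₀ hm_pos.le hle 2
  have hle_max : ∀ n ∈ Finset.Icc (K + 1) N, (h n) ^ 2 ≤ (etaK * m) ^ 2 := fun n hn => by
    have hle : |h n| ≤ etaK * m := by
      rw [hetaK, div_mul_cancel₀ _ hm_pos.ne']
      exact Finset.le_sup' (fun n => |h n|) hn
    rw [← sq_abs (h n)]
    exact pow_le_pow_left₀ (abs_nonneg _) hle 2
  have hAJ : ∑ n ∈ Finset.Icc 1 J, (lam n - lamavg) < 0 := by
    refine lt_of_le_of_ne (Finset.sum_nonpos fun n hn => ?_) fun h0 => ?_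
    · rw [Finset.mem_Icc] at hn
      exact hnonpos n hn.1 hn.2
    · rw [h0, div_zero] at hcond
      exact absurd hcond (sq_nonneg etaK).not_gt
  rw [lt_div_iff_of_neg hAJ] at hcond
  have hlow : ∑ n ∈ Finset.Icc 1 K, (lam n - lamavg) * (h n) ^ 2 ≤
      (∑ n ∈ Finset.Icc 1 K, (lam n - lamavg)) * m ^ 2 := by
    rw [Finset.sum_mul]
    refine Finset.sum_le_sum fun n hn => mul_le_mul_of_nonpos_left (hm_le n hn) ?_
    rw [Finset.mem_Icc] at hn
    exact hnonpos n hn.1 (hn.2.trans hKJ)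
  have hmid : ∑ n ∈ Finset.Ioc K J, (lam n - lamavg) * (h n) ^ 2 ≤ 0 := by
    refine Finset.sum_nonpos fun n hn => ?_
    rw [Finset.mem_Ioc] at hn
    exact mul_nonpos_of_nonpos_of_nonneg (hnonpos n (by omega) hn.2) (sq_nonneg _)
  have hhigh : ∑ n ∈ Finset.Ioc J N, (lam n - lamavg) * (h n) ^ 2 ≤
      (∑ n ∈ Finset.Ioc J N, (lam n - lamavg)) * (etaK * m) ^ 2 := by
    rw [Finset.sum_mul]
    refine Finset.sum_le_sum fun n hn => ?_
    rw [Finset.mem_Ioc] at hn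
    exact mul_le_mul_of_nonneg_left
      (hle_max n (Finset.mem_Icc.mpr ⟨by omega, hn.2⟩)) (hnonneg n hn.1 hn.2)
  have hJN' : J ≤ N := by omega
  rw [sum_Icc_one_eq_add_sum_Ioc _ hJN'] at hzero
  have hmain : ∑ n ∈ Finset.Icc 1 N, (lam n - lamavg) * (h n) ^ 2 < 0 := by
    rw [sum_Icc_one_eq_add_sum_Ioc _ hJN', sum_Icc_one_eq_add_sum_Ioc _ hKJ]
    rw [eq_neg_of_add_eq_zero_right hzero] at hhigh
    have hscaled := mul_lt_mul_of_pos_right hcond (pow_pos hm_pos 2)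
    linarith
  refine ⟨hmain, ?_⟩
  simp only [sub_mul, Finset.sum_sub_distrib, ← Finset.mul_sum] at hmain
  have hNpos : (0 : ℝ) < N := lt_of_le_of_ne (Nat.cast_nonneg N) hN0.symm
  rw [hsum, mul_assoc]
  exact mul_lt_mul_of_pos_left (sub_neg.mp hmain) hNpos
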